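/- For every real z ≠ 0 and all integers p ≥ 0 and ℓ ≥ 0: Σ_{k=0}^{ℓ} (−1)^k (2k+1)·[Σ_{m=0}^{p} c_m^{(p)}·(k−m+1)_{2m}]·[j_k(z)]² = (1/2)(−1)^ℓ·[Σ_{m=1}^{⌊p/2⌋} (−1)^{m+1} z^{2m} Σ_{n=0}^{p−2m} c_n^{(p−2m)}·(ℓ−n+1)_{2n+2}/(n+1) + δ_p^o·(−1)^{(p−1)/2} z^{p+1}]·[j_ℓ(z)]² + (1/2)(−1)^ℓ·[Σ_{m=1}^{⌊p/2⌋} (−1)^m z^{2m} Σ_{n=0}^{p−2m} c_n^{(p−2m)}·(ℓ−n)_{2n+2}/(n+1) + δ_p^o·(−1)^{(p+1)/2} z^{p+1}]·[j_{ℓ+1}(z)]² + (−1)^ℓ·[(ℓ+1)·Σ_{m=1}^{⌊p/2⌋} (−1)^{m+1} z^{2m−1} Σ_{n=0}^{p−2m} c_n^{(p−2m)}·(ℓ−n)_{2n+3}/((n+1)(n+2)) + δ_p^e·(−1)^{p/2} z^{p+1} + δ_p^o·(−1)^{(p−1)/2} z^p (ℓ+1)²]·j_ℓ(z)·j_{ℓ+1}(z)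 + δ_p^e·(−1)^{p/2} z^p j_0(2z) + δ_p^o·(−1)^{(p−1)/2} z^{p−1}·[(1/2)·j_0(2z) − z·j_1(2z)], where δ_p^e = 1 if p is even and 0 if p is odd, δ_p^o = 1 − δ_p^e, and ⌊x⌋ is the floor function. -/

import Mathlib

open Finset

/-- Auxiliary: `sphjAux z n` is the spherical Bessel function `j_{n-1}(z)`. -/
noncomputable def sphjAux (z : ℝ) : ℕ → ℝ
  | 0 => Real.cos z / z
  | 1 => Real.sin z / z
  | (n + 2) => ((2 * (n : ℝ) + 1) / z) * sphjAux z (n + 1) - sphjAux z n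

/-- The spherical Bessel function `j_k(z)` for integer `k ≥ -1`. -/
noncomputable def sphj (k : ℤ) (z : ℝ) : ℝ := sphjAux z (k + 1).toNat

/-- The Pochhammer symbol `(f)_n = f (f+1) ⋯ (f+n-1)`, with `(f)_0 = 1`. -/
noncomputable def poch (f : ℝ) (n : ℕ) : ℝ := ∏ i ∈ Finset.range n, (f + (i : ℝ))

/-- The coefficients `c_m^{(p)} = (2m-p+2)_{2p-2m} / (2^{2p-2m} m! (p-m)!)` for `0 ≤ m ≤ p`,
and `c_m^{(p)} = 0` for `m > p`. -/
noncomputable def cc (p m : ℕ) : ℝ :=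
  if m ≤ p then
    poch (2 * (m : ℝ) - p + 2) (2 * (p - m)) /
      (2 ^ (2 * (p - m)) * (m.factorial : ℝ) * ((p - m).factorial : ℝ))
  else 0

/-- `δ_p^e`: 1 if `p` is even, 0 if `p` is odd. -/
noncomputable def deltaE (p : ℕ) : ℝ := if Even p then 1 else 0

/-- `δ_p^o`: 1 if `p` is odd, 0 if `p` is even. -/
noncomputable def deltaO (p : ℕ) : ℝ := if Even p then 0 else 1

lemma sphj_nat (k : ℕ) (z : ℝ) : sphj (k : ℤ) z = sphjAux z (k + 1) := by
  unfold sphj; congr 1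

lemma sphj_nat_succ (k : ℕ) (z : ℝ) : sphj ((k : ℤ) + 1) z = sphjAux z (k + 2) := by
  unfold sphj; congr 1

lemma sphjAux_rec (z : ℝ) (n : ℕ) :
    sphjAux z (n + 2) = ((2 * (n : ℝ) + 1) / z) * sphjAux z (n + 1) - sphjAux z n := by
  rw [sphjAux]

lemma poch_succ (f : ℝ) (n : ℕ) : poch f (n + 1) = poch f n * (f + n) := by
  unfold poch; rw [Finset.prod_range_succ]

lemma poch_succ_left (f : ℝ) (n : ℕ) : poch f (n + 1) = f * poch (f + 1) n := by
  unfold poch; rw [Finset.prod_range_succ', mul_comm]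
  congr 1
  · simp
  · apply Finset.prod_congr rfl; intro i _; push_cast; ring

lemma poch_zero_of (f : ℝ) (n i : ℕ) (hi : i < n) (h : f + i = 0) : poch f n = 0 := by
  unfold poch; exact Finset.prod_eq_zero (Finset.mem_range.2 hi) h

lemma poch_zero (f : ℝ) : poch f 0 = 1 := by simp [poch]

/-- The polynomial multiplying `(2k+1) j_k^2`. -/
noncomputable def DD (p : ℕ) (x : ℝ) : ℝ :=
  ∑ m ∈ Finset.range (p + 1), cc p m * poch (x - m + 1) (2 * m)

noncomputable def SA (q : ℕ) (x : ℝ) : ℝ :=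
  ∑ n ∈ Finset.range (q + 1), cc q n * poch (x - n + 1) (2 * n + 2) / ((n : ℝ) + 1)

noncomputable def SB (q : ℕ) (x : ℝ) : ℝ :=
  ∑ n ∈ Finset.range (q + 1), cc q n * poch (x - n) (2 * n + 2) / ((n : ℝ) + 1)

noncomputable def TT (q : ℕ) (x : ℝ) : ℝ :=
  ∑ n ∈ Finset.range (q + 1), cc q n * poch (x - n) (2 * n + 3) / (((n : ℝ) + 1) * ((n : ℝ) + 2))

lemma SA_eq_SB (q : ℕ) (x : ℝ) : SA q x = SB q (x + 1) := by
  unfold SA SB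
  apply Finset.sum_congr rfl; intro n _
  rw [show x + 1 - (n : ℝ) = x - n + 1 by ring]

lemma SA_sub (q : ℕ) (x : ℝ) : SA q x - SB q (x - 1) = 2 * (2 * x + 1) * DD q x := by
  unfold SA SB DD
  rw [← Finset.sum_sub_distrib, Finset.mul_sum]
  apply Finset.sum_congr rfl; intro n _
  have hn : (n : ℝ) + 1 ≠ 0 := by positivity
  have h1 : poch (x - n + 1) (2 * n + 2)
      = poch (x - n + 1) (2 * n) * (x + n + 1) * (x + n + 2) := by
    rw [poch_succ, poch_succ]; push_cast; ring
  have h2 : poch (x - 1 - n) (2 * n + 2)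
      = poch (x - n + 1) (2 * n) * (x - 1 - n) * (x - n) := by
    rw [poch_succ_left, poch_succ_left, show x - 1 - (n : ℝ) + 1 + 1 = x - n + 1 by ring]; ring
  rw [h1, h2]; field_simp; ring

lemma TT_sub (q : ℕ) (x : ℝ) :
    (x + 1) * TT q x - x * TT q (x - 1) = (2 * x + 1) * SB q x := by
  unfold SB TT
  rw [Finset.mul_sum, Finset.mul_sum, Finset.mul_sum, ← Finset.sum_sub_distrib]
  apply Finset.sum_congr rfl; intro n _
  have hn : (n : ℝ) + 1 ≠ 0 := by positivity
  have hn2 : (n : ℝ) + 2 ≠ 0 := by positivity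
  have h1 : poch (x - n) (2 * n + 3) = poch (x - n) (2 * n + 2) * (x + n + 2) := by
    rw [poch_succ]; push_cast; ring
  have h2 : poch (x - 1 - n) (2 * n + 3) = poch (x - n) (2 * n + 2) * (x - 1 - n) := by
    rw [poch_succ_left, show x - 1 - (n : ℝ) + 1 = x - n by ring]; ring
  rw [h1, h2]; field_simp; ring

lemma cc_zero_ge_two (q : ℕ) : cc (q + 2) 0 = 0 := by
  unfold cc
  rw [if_pos (Nat.zero_le _), poch_zero_of _ _ q (by omega) (by push_cast; ring), zero_div]

lemma cc_one (q : ℕ) : cc (q + 2) 1 = 3 / 2 * cc q 0 := by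
  match q with
  | 0 => unfold cc poch; norm_num [Finset.prod_range_succ, Nat.factorial]
  | 1 => unfold cc poch; norm_num [Finset.prod_range_succ, Nat.factorial]
  | q + 2 =>
    rw [cc_zero_ge_two]
    unfold cc
    rw [if_pos (by omega), poch_zero_of _ _ q (by omega) (by push_cast; ring)]
    simp

lemma cc_rec (q n : ℕ) (hn : n ≤ q) :
    cc (q + 2) (n + 2) = cc q n / (((n : ℝ) + 1) * ((n : ℝ) + 2))
      + ((n : ℝ) + 5 / 2) / ((n : ℝ) + 2) * cc q (n + 1) := by
  have hn1 : (n : ℝ) + 1 ≠ 0 := by positivity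
  have hn2 : (n : ℝ) + 2 ≠ 0 := by positivity
  have hf : (n.factorial : ℝ) ≠ 0 := by positivity
  obtain ⟨d, rfl⟩ := Nat.exists_eq_add_of_le hn
  cases d with
  | zero =>
    have h : cc (n + 0) (n + 1) = 0 := by unfold cc; rw [if_neg (by omega)]
    rw [h]
    unfold cc
    rw [if_pos (by omega), if_pos (by omega)]
    simp only [Nat.add_zero, Nat.sub_self, Nat.mul_zero, poch_zero, pow_zero, Nat.factorial]
    push_cast
    field_simp
    ring
  | succ d =>
    unfold cc
    rw [if_pos (by omega), if_pos (by omega), if_pos (by omega)]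
    have e1 : n + (d + 1) + 2 - (n + 2) = d + 1 := by omega
    have e2 : n + (d + 1) - n = d + 1 := by omega
    have e3 : n + (d + 1) - (n + 1) = d := by omega
    rw [e1, e2, e3]
    have hd1 : (d : ℝ) + 1 ≠ 0 := by positivity
    have hfd : (d.factorial : ℝ) ≠ 0 := by positivity
    have p1 : poch (2 * ((n + 2 : ℕ) : ℝ) - ((n + (d + 1) + 2 : ℕ) : ℝ) + 2) (2 * (d + 1))
        = poch ((n : ℝ) - d + 3) (2 * d) * (n + d + 3) * (n + d + 4) := by
      rw [show 2 * (d + 1) = 2 * d + 1 + 1 by ring, poch_succ, poch_succ,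
        show 2 * ((n + 2 : ℕ) : ℝ) - ((n + (d + 1) + 2 : ℕ) : ℝ) + 2 = (n : ℝ) - d + 3 by
          push_cast; ring]
      push_cast; ring
    have p2 : poch (2 * (n : ℝ) - ((n + (d + 1) : ℕ) : ℝ) + 2) (2 * (d + 1))
        = poch ((n : ℝ) - d + 3) (2 * d) * (n - d + 1) * (n - d + 2) := by
      rw [show 2 * (d + 1) = 2 * d + 1 + 1 by ring, poch_succ_left, poch_succ_left,
        show 2 * (n : ℝ) - ((n + (d + 1) : ℕ) : ℝ) + 2 + 1 + 1 = (n : ℝ) - d + 3 by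
          push_cast; ring]
      push_cast; ring
    have p3 : poch (2 * ((n + 1 : ℕ) : ℝ) - ((n + (d + 1) : ℕ) : ℝ) + 2) (2 * d)
        = poch ((n : ℝ) - d + 3) (2 * d) := by
      congr 1; push_cast; ring
    rw [p1, p2, p3]
    generalize poch ((n : ℝ) - d + 3) (2 * d) = X
    simp only [Nat.factorial, Nat.mul_succ, pow_add]
    push_cast
    field_simp
    ring

/-- Key identity linking consecutive polynomials of the same parity. -/
lemma DD_key (q : ℕ) (x : ℝ) :
    DD (q + 2) x = (x + 1 / 2) * SB q x + x * TT q (x - 1) := by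
  have hR : (x + 1 / 2) * SB q x + x * TT q (x - 1)
      = ∑ n ∈ Finset.range (q + 1),
          (cc q n / (((n : ℝ) + 1) * ((n : ℝ) + 2)) * poch (x - n - 1) (2 * n + 4)
            + ((n : ℝ) + 3 / 2) / ((n : ℝ) + 1) * cc q n * poch (x - n) (2 * n + 2)) := by
    unfold SB TT
    rw [Finset.mul_sum, Finset.mul_sum, ← Finset.sum_add_distrib]
    apply Finset.sum_congr rfl; intro n _
    have hn : (n : ℝ) + 1 ≠ 0 := by positivity
    have hn2 : (n : ℝ) + 2 ≠ 0 := by positivity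
    have h2 : poch (x - 1 - n) (2 * n + 3) = poch (x - n) (2 * n + 2) * (x - 1 - n) := by
      rw [poch_succ_left, show x - 1 - (n : ℝ) + 1 = x - n by ring]; ring
    have h3 : poch (x - n - 1) (2 * n + 4)
        = poch (x - n) (2 * n + 2) * (x - 1 - n) * (x + n + 2) := by
      rw [poch_succ_left, poch_succ, show x - (n : ℝ) - 1 + 1 = x - n by ring]
      push_cast; ring
    rw [h2, h3]; field_simp; ring
  rw [hR, Finset.sum_add_distrib]
  unfold DD
  rw [Finset.sum_range_succ', cc_zero_ge_two, Finset.sum_range_succ', zero_mul, add_zero]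
  have hG : ∑ n ∈ Finset.range (q + 1),
        ((n : ℝ) + 3 / 2) / ((n : ℝ) + 1) * cc q n * poch (x - n) (2 * n + 2)
      = ∑ n ∈ Finset.range (q + 1 + 1),
        ((n : ℝ) + 3 / 2) / ((n : ℝ) + 1) * cc q n * poch (x - n) (2 * n + 2) := by
    rw [Finset.sum_range_succ _ (q + 1)]
    have : cc q (q + 1) = 0 := by unfold cc; rw [if_neg (by omega)]
    rw [this]; simp
  rw [hG, Finset.sum_range_succ' _ (q + 1), ← add_assoc, ← Finset.sum_add_distrib]
  congr 1
  · apply Finset.sum_congr rfl; intro n hn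
    rw [cc_rec q n (by simpa [Nat.lt_succ_iff] using hn)]
    have a1 : x - ((n + 1 + 1 : ℕ) : ℝ) + 1 = x - n - 1 := by push_cast; ring
    have a2 : x - ((n + 1 : ℕ) : ℝ) = x - n - 1 := by push_cast; ring
    rw [a1, a2, show 2 * (n + 1 + 1) = 2 * n + 4 by ring, show 2 * (n + 1) + 2 = 2 * n + 4 by ring]
    push_cast
    rw [show (n : ℝ) + 1 + 3 / 2 = n + 5 / 2 by ring, show (n : ℝ) + 1 + 1 = n + 2 by ring]
    ring
  · rw [show 0 + 1 = 1 from rfl, cc_one]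
    have a1 : x - ((1 : ℕ) : ℝ) + 1 = x - ((0 : ℕ) : ℝ) := by push_cast; ring
    rw [a1]; norm_num

lemma SB_zero (q : ℕ) : SB q 0 = 0 := by
  unfold SB; apply Finset.sum_eq_zero; intro n _
  rw [poch_zero_of _ _ n (by omega) (by ring)]; simp

lemma SB_neg_one (q : ℕ) : SB q (-1) = 0 := by
  unfold SB; apply Finset.sum_eq_zero; intro n _
  rw [poch_zero_of _ _ (n + 1) (by omega) (by push_cast; ring)]; simp

/-- Two-step relation, summed over `k < L`. -/
lemma step_sum (z : ℝ) (hz : z ≠ 0) (q L : ℕ) :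
    ∑ k ∈ Finset.range L, (-1 : ℝ) ^ k * (2 * (k : ℝ) + 1) *
        (DD (q + 2) k + z ^ 2 * DD q k) * sphjAux z (k + 1) ^ 2
      = -(-1 : ℝ) ^ L * (1 / 2 * z ^ 2 * SB q L * sphjAux z L ^ 2
          - 1 / 2 * z ^ 2 * SB q (L - 1) * sphjAux z (L + 1) ^ 2
          + L * z * TT q (L - 1) * sphjAux z L * sphjAux z (L + 1)) := by
  induction L with
  | zero => simp [SB_zero, SB_neg_one]
  | succ L ih =>
    rw [Finset.sum_range_succ, ih, sphjAux_rec, DD_key]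
    have h1 := SA_sub q L
    rw [SA_eq_SB] at h1
    have h2 := TT_sub q L
    push_cast
    rw [show (L : ℝ) + 1 - 1 = L by ring]
    have h1' : SB q ((L : ℝ) + 1) = SB q (L - 1) + 2 * (2 * L + 1) * DD q L := by linarith
    have h2' : ((L : ℝ) + 1) * TT q L = L * TT q (L - 1) + (2 * L + 1) * SB q L := by linarith
    rw [h1', mul_right_comm ((L : ℝ) + 1) z, h2', pow_succ]
    field_simp
    ring

lemma base0 (z : ℝ) (hz : z ≠ 0) (L : ℕ) :
    ∑ k ∈ Finset.range L, (-1 : ℝ) ^ k * (2 * (k : ℝ) + 1) * sphjAux z (k + 1) ^ 2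
      = -(-1 : ℝ) ^ L * z * sphjAux z L * sphjAux z (L + 1) + sphjAux (2 * z) 1 := by
  induction L with
  | zero =>
    simp only [Finset.range_zero, Finset.sum_empty, sphjAux, Real.sin_two_mul]
    field_simp; ring
  | succ L ih =>
    rw [Finset.sum_range_succ, ih, sphjAux_rec z L, pow_succ]
    field_simp; ring

lemma base1 (z : ℝ) (hz : z ≠ 0) (L : ℕ) :
    ∑ k ∈ Finset.range L, (-1 : ℝ) ^ k * (2 * (k : ℝ) + 1) * (1 / 2 + k * (k + 1))
        * sphjAux z (k + 1) ^ 2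
      = -(-1 : ℝ) ^ L * (1 / 2 * z ^ 2 * sphjAux z L ^ 2 - 1 / 2 * z ^ 2 * sphjAux z (L + 1) ^ 2
          + z * L ^ 2 * sphjAux z L * sphjAux z (L + 1))
        + (1 / 2 * sphjAux (2 * z) 1 - z * sphjAux (2 * z) 2) := by
  induction L with
  | zero =>
    simp only [Finset.range_zero, Finset.sum_empty, sphjAux, Real.sin_two_mul, Real.cos_two_mul']
    field_simp; push_cast; ring
  | succ L ih =>
    rw [Finset.sum_range_succ, ih, sphjAux_rec z L, pow_succ]
    push_cast
    field_simp; ring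

lemma DD_zero (x : ℝ) : DD 0 x = 1 := by
  unfold DD cc poch; norm_num

lemma DD_one (x : ℝ) : DD 1 x = 1 / 2 + x * (x + 1) := by
  unfold DD cc poch; norm_num [Finset.sum_range_succ, Finset.prod_range_succ]

lemma sum_Icc_shift (f : ℕ → ℝ) (N : ℕ) :
    ∑ m ∈ Finset.Icc 1 (N + 1), f m = f 1 + ∑ m ∈ Finset.Icc 1 N, f (m + 1) := by
  induction N with
  | zero => simp
  | succ N ih =>
    rw [Finset.sum_Icc_succ_top (by omega), ih, Finset.sum_Icc_succ_top (by omega)]; ring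

/-- Shifting `p` by two in the sums over `m`. -/
lemma sum_shift2 (a F : ℕ → ℝ) (c : ℝ) (p : ℕ)
    (hab : ∀ m, 1 ≤ m → a (m + 1) = c * a m) :
    ∑ m ∈ Finset.Icc 1 ((p + 2) / 2), a m * F (p + 2 - 2 * m)
      = a 1 * F p + c * ∑ m ∈ Finset.Icc 1 (p / 2), a m * F (p - 2 * m) := by
  rw [show (p + 2) / 2 = p / 2 + 1 by omega, sum_Icc_shift, Finset.mul_sum]
  congr 1
  apply Finset.sum_congr rfl; intro m hm
  rw [hab m (Finset.mem_Icc.1 hm).1, show p + 2 - 2 * (m + 1) = p - 2 * m by omega]; ring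

lemma deltaO_shift (p : ℕ) :
    deltaO (p + 2) * (-1 : ℝ) ^ ((p + 2 - 1) / 2) = -(deltaO p * (-1 : ℝ) ^ ((p - 1) / 2)) := by
  unfold deltaO
  rcases Nat.even_or_odd' p with ⟨r, rfl | rfl⟩
  · simp [Nat.even_add]
  · rw [show (2 * r + 1 + 2 - 1) / 2 = r + 1 by omega, show (2 * r + 1 - 1) / 2 = r by omega]
    simp [Nat.even_add, pow_succ]

lemma deltaE_shift (p : ℕ) :
    deltaE (p + 2) * (-1 : ℝ) ^ ((p + 2) / 2) = -(deltaE p * (-1 : ℝ) ^ (p / 2)) := by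
  rw [show (p + 2) / 2 = p / 2 + 1 by omega, pow_succ]
  simp [deltaE, Nat.even_add]

lemma deltaO_pow (z : ℝ) (p : ℕ) :
    deltaO p * z ^ (p + 2 - 1) = deltaO p * (z ^ 2 * z ^ (p - 1)) := by
  unfold deltaO
  rcases Nat.even_or_odd' p with ⟨r, rfl | rfl⟩
  · simp
  · rw [show 2 * r + 1 + 2 - 1 = 2 + 2 * r by omega, show 2 * r + 1 - 1 = 2 * r by omega, pow_add]

/-- The explicit sum rules with alternating coefficients, for every `p ≥ 0`. -/
theorem alternating_sum_rule_all_p (z : ℝ) (hz : z ≠ 0) (p ℓ : ℕ) :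
    ∑ k ∈ Finset.range (ℓ + 1),
        (-1 : ℝ) ^ k * (2 * (k : ℝ) + 1) *
          (∑ m ∈ Finset.range (p + 1), cc p m * poch ((k : ℝ) - m + 1) (2 * m)) *
          (sphj k z) ^ 2 =
      (1 / 2) * (-1 : ℝ) ^ ℓ *
          (∑ m ∈ Finset.Icc 1 (p / 2), (-1 : ℝ) ^ (m + 1) * z ^ (2 * m) *
              ∑ n ∈ Finset.range (p - 2 * m + 1),
                cc (p - 2 * m) n * poch ((ℓ : ℝ) - n + 1) (2 * n + 2) / ((n : ℝ) + 1) +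
            deltaO p * (-1 : ℝ) ^ ((p - 1) / 2) * z ^ (p + 1)) *
          (sphj ℓ z) ^ 2 +
        (1 / 2) * (-1 : ℝ) ^ ℓ *
          (∑ m ∈ Finset.Icc 1 (p / 2), (-1 : ℝ) ^ m * z ^ (2 * m) *
              ∑ n ∈ Finset.range (p - 2 * m + 1),
                cc (p - 2 * m) n * poch ((ℓ : ℝ) - n) (2 * n + 2) / ((n : ℝ) + 1) +
            deltaO p * (-1 : ℝ) ^ ((p + 1) / 2) * z ^ (p + 1)) *
          (sphj (ℓ + 1) z) ^ 2 +
        (-1 : ℝ) ^ ℓ *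
          (((ℓ : ℝ) + 1) *
              ∑ m ∈ Finset.Icc 1 (p / 2), (-1 : ℝ) ^ (m + 1) * z ^ (2 * m - 1) *
                ∑ n ∈ Finset.range (p - 2 * m + 1),
                  cc (p - 2 * m) n * poch ((ℓ : ℝ) - n) (2 * n + 3) /
                    (((n : ℝ) + 1) * ((n : ℝ) + 2)) +
            deltaE p * (-1 : ℝ) ^ (p / 2) * z ^ (p + 1) +
            deltaO p * (-1 : ℝ) ^ ((p - 1) / 2) * z ^ p * ((ℓ : ℝ) + 1) ^ 2) *
          sphj ℓ z * sphj (ℓ + 1) z +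
        deltaE p * (-1 : ℝ) ^ (p / 2) * z ^ p * sphj 0 (2 * z) +
        deltaO p * (-1 : ℝ) ^ ((p - 1) / 2) * z ^ (p - 1) *
          ((1 / 2) * sphj 0 (2 * z) - z * sphj 1 (2 * z)) := by
  simp only [sphj_nat, sphj_nat_succ]
  have e0 : sphj 0 (2 * z) = sphjAux (2 * z) 1 := sphj_nat 0 _
  have e1 : sphj 1 (2 * z) = sphjAux (2 * z) 2 := sphj_nat 1 _
  rw [e0, e1]
  change ∑ k ∈ Finset.range (ℓ + 1),
        (-1 : ℝ) ^ k * (2 * (k : ℝ) + 1) * DD p k * (sphjAux z (k + 1)) ^ 2 =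
      (1 / 2) * (-1 : ℝ) ^ ℓ *
          (∑ m ∈ Finset.Icc 1 (p / 2), (-1 : ℝ) ^ (m + 1) * z ^ (2 * m) * SA (p - 2 * m) ℓ +
            deltaO p * (-1 : ℝ) ^ ((p - 1) / 2) * z ^ (p + 1)) *
          (sphjAux z (ℓ + 1)) ^ 2 +
        (1 / 2) * (-1 : ℝ) ^ ℓ *
          (∑ m ∈ Finset.Icc 1 (p / 2), (-1 : ℝ) ^ m * z ^ (2 * m) * SB (p - 2 * m) ℓ +
            deltaO p * (-1 : ℝ) ^ ((p + 1) / 2) * z ^ (p + 1)) *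
          (sphjAux z (ℓ + 2)) ^ 2 +
        (-1 : ℝ) ^ ℓ *
          (((ℓ : ℝ) + 1) *
              ∑ m ∈ Finset.Icc 1 (p / 2), (-1 : ℝ) ^ (m + 1) * z ^ (2 * m - 1) *
                TT (p - 2 * m) ℓ +
            deltaE p * (-1 : ℝ) ^ (p / 2) * z ^ (p + 1) +
            deltaO p * (-1 : ℝ) ^ ((p - 1) / 2) * z ^ p * ((ℓ : ℝ) + 1) ^ 2) *
          sphjAux z (ℓ + 1) * sphjAux z (ℓ + 2) +
        deltaE p * (-1 : ℝ) ^ (p / 2) * z ^ p * sphjAux (2 * z) 1 +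
        deltaO p * (-1 : ℝ) ^ ((p - 1) / 2) * z ^ (p - 1) *
          ((1 / 2) * sphjAux (2 * z) 1 - z * sphjAux (2 * z) 2)
  induction p using Nat.twoStepInduction with
  | zero =>
    have h := base0 z hz (ℓ + 1)
    simp only [DD_zero, mul_one]
    rw [h]
    simp [deltaE, deltaO, pow_succ]
  | one =>
    have h := base1 z hz (ℓ + 1)
    simp only [DD_one]
    rw [h]
    simp [deltaE, deltaO, pow_succ]
    ring
  | more p ih _ =>
    have hs := step_sum z hz p (ℓ + 1)
    have hsplit : ∑ k ∈ Finset.range (ℓ + 1), (-1 : ℝ) ^ k * (2 * (k : ℝ) + 1) *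
          (DD (p + 2) k + z ^ 2 * DD p k) * sphjAux z (k + 1) ^ 2
        = ∑ k ∈ Finset.range (ℓ + 1), (-1 : ℝ) ^ k * (2 * (k : ℝ) + 1) *
            DD (p + 2) k * sphjAux z (k + 1) ^ 2
          + z ^ 2 * ∑ k ∈ Finset.range (ℓ + 1), (-1 : ℝ) ^ k * (2 * (k : ℝ) + 1) *
            DD p k * sphjAux z (k + 1) ^ 2 := by
      rw [Finset.mul_sum, ← Finset.sum_add_distrib]
      apply Finset.sum_congr rfl; intro k _; ring
    rw [hsplit, ih] at hs
    push_cast at hs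
    rw [show (ℓ : ℝ) + 1 - 1 = ℓ by ring, ← SA_eq_SB] at hs
    rw [eq_sub_of_add_eq hs]
    have s1 := sum_shift2 (fun m => (-1 : ℝ) ^ (m + 1) * z ^ (2 * m)) (fun q => SA q ℓ)
      (-z ^ 2) p (fun m _ => by ring)
    have s2 := sum_shift2 (fun m => (-1 : ℝ) ^ m * z ^ (2 * m)) (fun q => SB q ℓ)
      (-z ^ 2) p (fun m _ => by ring)
    have s3 := sum_shift2 (fun m => (-1 : ℝ) ^ (m + 1) * z ^ (2 * m - 1)) (fun q => TT q ℓ)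
      (-z ^ 2) p (fun m hm => by
        obtain ⟨r, rfl⟩ := Nat.exists_eq_add_of_le hm
        rw [show 2 * (1 + r + 1) - 1 = 2 * r + 1 + 2 by omega,
          show 2 * (1 + r) - 1 = 2 * r + 1 by omega]
        ring)
    rw [s1, s2, s3]
    have d3 : (-1 : ℝ) ^ ((p + 2 + 1) / 2) = -(-1 : ℝ) ^ ((p + 1) / 2) := by
      rw [show (p + 2 + 1) / 2 = (p + 1) / 2 + 1 by omega, pow_succ]; ring
    have dO : deltaO (p + 2) = deltaO p := by simp [deltaO, Nat.even_add]
    have d4 : deltaO (p + 2) * (-1 : ℝ) ^ ((p + 2 - 1) / 2) * z ^ (p + 2 - 1)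
        = -(deltaO p * (-1 : ℝ) ^ ((p - 1) / 2)) * (z ^ 2 * z ^ (p - 1)) := by
      rw [deltaO_shift]
      linear_combination (-(-1 : ℝ) ^ ((p - 1) / 2)) * deltaO_pow z p
    rw [d4, deltaO_shift, deltaE_shift, d3, dO]
    ring
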